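/- arXiv:1909.13152 — 2 statements merged into one kernel-verified Lean document; each statement's English description precedes it below -/
import Mathlib

section
/- (Lemma 4.1, part 2) Let |ψ⟩ be a pure four-qudit state that is biseparable as one particle versus the remaining three, i.e. |ψ⟩ = |ψ_t⟩ ⊗ |ψ_rest⟩ (up to ordering of tensor factors) for some party t ∈ {A, B, C, D}, where |ψ_t⟩ is a unit vector in ℂ^d and |ψ_rest⟩ is a unit vector in the tensor product of the other three factors; let ρ = |ψ⟩⟨ψ|. Then for every integer k with 1 ≤ k ≤ (d²−1)², the Ky Fan k-norm of the realigned matrix M^{(AB)(CD)} satisfies ‖M^{(AB)(CD)}‖_k ≤ √k·(d−1)·√((d−1)(d+2)). -/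
open Matrix ComplexOrder

namespace SpinCorrGME

/-- The singular values of a square complex matrix `S`, indexed by the row type:
the square roots of the eigenvalues of the positive semidefinite matrix `Sᴴ * S`. -/
noncomputable def singularValues {n : Type*} [Fintype n] [DecidableEq n]
    (S : Matrix n n ℂ) : n → ℝ :=
  fun i => Real.sqrt ((Matrix.posSemidef_conjTranspose_mul_self S).isHermitian.eigenvalues i)

/-- The Ky Fan `k`-norm of a square complex matrix: the sum of its `k` largest singular
values, expressed as the maximum of `∑ i ∈ t, σ_i` over all subsets `t` of cardinality
`k` (and `0` if `k` exceeds the size of the matrix). -/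
noncomputable def kyFan {n : Type*} [Fintype n] [DecidableEq n] (k : ℕ)
    (S : Matrix n n ℂ) : ℝ :=
  if h : (Finset.powersetCard k (Finset.univ : Finset n)).Nonempty then
    (Finset.powersetCard k (Finset.univ : Finset n)).sup' h
      (fun t => ∑ i ∈ t, singularValues S i)
  else 0

variable {d : ℕ}

/-- Tensor (Kronecker) product of four `d × d` matrices, acting on `(ℂ^d)^{⊗4}`. -/
noncomputable def kron4 (A B C D : Matrix (Fin d) (Fin d) ℂ) :
    Matrix (Fin d × Fin d × Fin d × Fin d) (Fin d × Fin d × Fin d × Fin d) ℂ :=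
  Matrix.of fun p q =>
    A p.1 q.1 * B p.2.1 q.2.1 * C p.2.2.1 q.2.2.1 * D p.2.2.2 q.2.2.2

/-- The rank-one projector `|ψ⟩⟨ψ|` onto a vector of `(ℂ^d)^{⊗4}`. -/
noncomputable def outer (ψ : Fin d × Fin d × Fin d × Fin d → ℂ) :
    Matrix (Fin d × Fin d × Fin d × Fin d) (Fin d × Fin d × Fin d × Fin d) ℂ :=
  Matrix.of fun p q => ψ p * (starRingEnd ℂ) (ψ q)

/-- A vector is normalized (a unit vector). -/
def unitNorm {α : Type*} [Fintype α] (v : α → ℂ) : Prop := ∑ x, ‖v x‖ ^ 2 = 1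

variable (lam : Fin (d ^ 2 - 1) → Matrix (Fin d) (Fin d) ℂ)
variable (ρ : Matrix (Fin d × Fin d × Fin d × Fin d) (Fin d × Fin d × Fin d × Fin d) ℂ)

/-- The realignment `M^{(AB)(CD)}` of the four-body correlation tensor
`R^{ABCD}_{ijlm} = tr(ρ · λ_i ⊗ λ_j ⊗ λ_l ⊗ λ_m)`: rows indexed by `(i,j)`,
columns indexed by `(l,m)`. -/
noncomputable def MABCD :
    Matrix (Fin (d ^ 2 - 1) × Fin (d ^ 2 - 1)) (Fin (d ^ 2 - 1) × Fin (d ^ 2 - 1)) ℂ :=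
  Matrix.of fun p q => (ρ * kron4 (lam p.1) (lam p.2) (lam q.1) (lam q.2)).trace

/-- The realignment `M^{(AC)(BD)}`: rows indexed by `(i,l)`, columns by `(j,m)`. -/
noncomputable def MACBD :
    Matrix (Fin (d ^ 2 - 1) × Fin (d ^ 2 - 1)) (Fin (d ^ 2 - 1) × Fin (d ^ 2 - 1)) ℂ :=
  Matrix.of fun p q => (ρ * kron4 (lam p.1) (lam q.1) (lam p.2) (lam q.2)).trace

/-- The realignment `M^{(AD)(BC)}`: rows indexed by `(i,m)`, columns by `(j,l)`. -/
noncomputable def MADBC :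
    Matrix (Fin (d ^ 2 - 1) × Fin (d ^ 2 - 1)) (Fin (d ^ 2 - 1) × Fin (d ^ 2 - 1)) ℂ :=
  Matrix.of fun p q => (ρ * kron4 (lam p.1) (lam q.1) (lam q.2) (lam p.2)).trace

section KyFan

lemma sum_sq_singularValues {n : Type*} [Fintype n] [DecidableEq n] (S : Matrix n n ℂ) :
    ∑ i, singularValues S i ^ 2 = ∑ i, ∑ j, ‖S i j‖ ^ 2 := by
  have hS := Matrix.posSemidef_conjTranspose_mul_self S
  have h1 : ∑ i, singularValues S i ^ 2 = ∑ i, hS.isHermitian.eigenvalues i :=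
    Finset.sum_congr rfl fun i _ => Real.sq_sqrt (hS.eigenvalues_nonneg i)
  have h2 := hS.isHermitian.trace_eq_sum_eigenvalues
  rw [h1, Finset.sum_comm]
  apply Complex.ofReal_injective
  push_cast
  refine h2.symm.trans ?_
  simp only [Matrix.trace, Matrix.diag_apply, Matrix.mul_apply, Matrix.conjTranspose_apply]
  refine Finset.sum_congr rfl fun i _ => Finset.sum_congr rfl fun j _ => ?_
  exact Complex.conj_mul' _

/-- The Ky Fan `k`-norm is at most `√k` times the Frobenius norm. -/
lemma kyFan_le_sqrt_mul_sqrt {n : Type*} [Fintype n] [DecidableEq n] (k : ℕ)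
    (S : Matrix n n ℂ) :
    kyFan k S ≤ √k * √(∑ i, ∑ j, ‖S i j‖ ^ 2) := by
  unfold kyFan
  split_ifs with h
  · refine Finset.sup'_le _ _ fun t ht => ?_
    rw [← Real.sqrt_mul (Nat.cast_nonneg k)]
    refine Real.le_sqrt_of_sq_le (sq_sum_le_card_mul_sum_sq.trans ?_)
    rw [(Finset.mem_powersetCard.1 ht).2, ← sum_sq_singularValues]
    gcongr
    exact Finset.subset_univ t
  · positivity

end KyFan

section Purity

variable {α β : Type*} [Fintype α] [Fintype β]

/-- The purities of the two marginals of a bipartite pure state agree. -/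
lemma sum_norm_sq_marginal_comm (v : α → β → ℂ) :
    ∑ x, ∑ x', ‖∑ y, v x y * (starRingEnd ℂ) (v x' y)‖ ^ 2 =
      ∑ y, ∑ y', ‖∑ x, v x y * (starRingEnd ℂ) (v x y')‖ ^ 2 := by
  apply Complex.ofReal_injective
  push_cast
  simp only [← Complex.mul_conj', map_sum, map_mul, Complex.conj_conj, Finset.sum_mul_sum]
  calc ∑ x, ∑ x', ∑ y, ∑ y', v x y * (starRingEnd ℂ) (v x' y) *
        ((starRingEnd ℂ) (v x y') * v x' y')
      = ∑ x, ∑ y, ∑ y', ∑ x', v x y * (starRingEnd ℂ) (v x' y) *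
        ((starRingEnd ℂ) (v x y') * v x' y') := by
        refine Finset.sum_congr rfl fun x _ => ?_
        rw [Finset.sum_comm]
        exact Finset.sum_congr rfl fun y _ => Finset.sum_comm
    _ = ∑ y, ∑ y', ∑ x, ∑ x', v x y * (starRingEnd ℂ) (v x' y) *
        ((starRingEnd ℂ) (v x y') * v x' y') := by
        rw [Finset.sum_comm]
        exact Finset.sum_congr rfl fun y _ => Finset.sum_comm
    _ = _ := by
        refine Finset.sum_congr rfl fun y _ => Finset.sum_congr rfl fun y' _ =>
          Finset.sum_congr rfl fun x _ => Finset.sum_congr rfl fun x' _ => ?_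
        ring

/-- The purity of a marginal of a bipartite pure state is at least the inverse dimension. -/
lemma one_le_card_mul_sum_norm_sq_marginal (v : α → β → ℂ) (hv : ∑ x, ∑ y, ‖v x y‖ ^ 2 = 1) :
    1 ≤ (Fintype.card α : ℝ) * ∑ x, ∑ x', ‖∑ y, v x y * (starRingEnd ℂ) (v x' y)‖ ^ 2 := by
  have h1 : ∀ x, (∑ y, ‖v x y‖ ^ 2) ^ 2 ≤
      ∑ x', ‖∑ y, v x y * (starRingEnd ℂ) (v x' y)‖ ^ 2 := fun x => by
    have h2 : ‖∑ y, v x y * (starRingEnd ℂ) (v x y)‖ ^ 2 = (∑ y, ‖v x y‖ ^ 2) ^ 2 := by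
      simp only [Complex.mul_conj']
      norm_cast
      rw [Real.norm_eq_abs, sq_abs]
    rw [← h2]
    exact Finset.single_le_sum (f := fun x' => ‖∑ y, v x y * (starRingEnd ℂ) (v x' y)‖ ^ 2)
      (fun _ _ => by positivity) (Finset.mem_univ x)
  calc (1 : ℝ) = (∑ x, ∑ y, ‖v x y‖ ^ 2) ^ 2 := by rw [hv, one_pow]
    _ ≤ (Fintype.card α : ℝ) * ∑ x, (∑ y, ‖v x y‖ ^ 2) ^ 2 := sq_sum_le_card_mul_sum_sq
    _ ≤ _ := by
      gcongr with x _
      exact h1 x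

end Purity

section Correlation

/-- The bilinear pairing `∑ F a b X b a = tr (F X)`. -/
noncomputable def pairing (X : Matrix (Fin d) (Fin d) ℂ) (F : Fin d → Fin d → ℂ) : ℂ :=
  ∑ a, ∑ b, F a b * X b a

lemma sum_pairing {ι : Type*} (s : Finset ι) (X : Matrix (Fin d) (Fin d) ℂ)
    (F : ι → Fin d → Fin d → ℂ) :
    ∑ x ∈ s, pairing X (F x) = pairing X fun a b => ∑ x ∈ s, F x a b := by
  simp only [pairing, Finset.sum_mul]
  rw [Finset.sum_comm]
  exact Finset.sum_congr rfl fun a _ => Finset.sum_comm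

variable {lam}

lemma sum_prod_sum_prod {α β M : Type*} [Fintype α] [Fintype β] [AddCommMonoid M]
    (f : α × β → α × β → M) :
    ∑ p, ∑ q, f p q = ∑ a, ∑ a', ∑ b, ∑ b', f (a, b) (a', b') := by
  simp only [Fintype.sum_prod_type]
  exact Finset.sum_congr rfl fun a _ => Finset.sum_comm

lemma pairing_mul_left (X : Matrix (Fin d) (Fin d) ℂ) (z : ℂ) (F : Fin d → Fin d → ℂ) :
    (pairing X fun a b => z * F a b) = z * pairing X F := by
  simp only [pairing, Finset.mul_sum, mul_assoc]

lemma pairing_mul_right (X : Matrix (Fin d) (Fin d) ℂ) (z : ℂ) (F : Fin d → Fin d → ℂ) :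
    (pairing X fun a b => F a b * z) = pairing X F * z := by
  simp only [mul_comm _ z, pairing_mul_left]

/-- Parseval's identity for the orthogonal basis formed by the identity and the `lam i`. -/
lemma sum_norm_sq_pairing (hd : 2 ≤ d) (hherm : ∀ i, (lam i).IsHermitian)
    (htr0 : ∀ i, (lam i).trace = 0)
    (horth : ∀ i j, (lam i * lam j).trace = if i = j then (d : ℂ) else 0)
    (F : Fin d → Fin d → ℂ) :
    ∑ i, ‖pairing (lam i) F‖ ^ 2 =
      d * ∑ a, ∑ b, ‖F a b‖ ^ 2 - ‖∑ a, F a a‖ ^ 2 := by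
  let B : Option (Fin (d ^ 2 - 1)) → Matrix (Fin d) (Fin d) ℂ := fun o => o.elim 1 lam
  have hB : ∀ o, (B o).IsHermitian := by
    rintro (_ | i)
    · exact Matrix.isHermitian_one
    · exact hherm i
  have hBo : ∀ o o', (B o * B o').trace = if o = o' then (d : ℂ) else 0 := by
    rintro (_ | i) (_ | j) <;> simp [B, htr0, horth]
  have hd0 : (d : ℂ) ≠ 0 := by
    norm_cast
    omega
  let U : Matrix (Option (Fin (d ^ 2 - 1))) (Fin d × Fin d) ℂ :=
    Matrix.of fun o p => B o p.2 p.1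
  have hUU : U * ((d : ℂ)⁻¹ • Uᴴ) = 1 := by
    ext o o'
    have h : (U * Uᴴ) o o' = (B o * B o').trace := by
      simp only [U, Matrix.mul_apply, Matrix.conjTranspose_apply, Matrix.of_apply, Matrix.trace,
        Matrix.diag_apply, Fintype.sum_prod_type]
      rw [Finset.sum_comm]
      exact Finset.sum_congr rfl fun a _ => Finset.sum_congr rfl fun b _ => by
        rw [(hB o').apply]
    rw [Matrix.mul_smul, Matrix.smul_apply, h, hBo, Matrix.one_apply]
    split_ifs <;> simp [hd0]
  have hcard : Fintype.card (Option (Fin (d ^ 2 - 1))) = Fintype.card (Fin d × Fin d) := by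
    simp only [Fintype.card_option, Fintype.card_fin, Fintype.card_prod]
    have : 1 ≤ d ^ 2 := Nat.one_le_pow _ _ (by omega)
    rw [Nat.sub_add_cancel this, sq]
  have hUU' : Uᴴ * U = (d : ℂ) • 1 := by
    have h := (Matrix.mul_eq_one_comm_of_equiv (Fintype.equivOfCardEq hcard)).1 hUU
    rw [← h, Matrix.smul_mul, smul_smul, mul_inv_cancel₀ hd0, one_smul]
  let f : Fin d × Fin d → ℂ := fun p => F p.1 p.2
  have hkey : star (U *ᵥ f) ⬝ᵥ (U *ᵥ f) = d * (star f ⬝ᵥ f) := by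
    rw [Matrix.star_mulVec, Matrix.dotProduct_mulVec, Matrix.vecMul_vecMul, hUU',
      Matrix.vecMul_smul, Matrix.vecMul_one, smul_dotProduct, smul_eq_mul]
  have hUf : ∀ o, (U *ᵥ f) o = pairing (B o) F := fun o => by
    simp only [Matrix.mulVec, dotProduct, Fintype.sum_prod_type, U, f, pairing, Matrix.of_apply,
      mul_comm]
  have hnone : pairing (B none) F = ∑ a, F a a := by
    simp [B, pairing, Matrix.one_apply]
  simp only [dotProduct, Pi.star_apply, RCLike.star_def, Complex.conj_mul', hUf,
    Fintype.sum_option, hnone, Fintype.sum_prod_type, f] at hkey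
  norm_cast at hkey
  rw [← hkey, add_sub_cancel_left]
  rfl

lemma sum_norm_sq_pairing_pairing (hd : 2 ≤ d) (hherm : ∀ i, (lam i).IsHermitian)
    (htr0 : ∀ i, (lam i).trace = 0)
    (horth : ∀ i j, (lam i * lam j).trace = if i = j then (d : ℂ) else 0)
    (G : Fin d → Fin d → Fin d → Fin d → ℂ) :
    ∑ i, ∑ j, ‖pairing (lam i) fun a a' => pairing (lam j) (G a a')‖ ^ 2 =
      d ^ 2 * (∑ a, ∑ a', ∑ b, ∑ b', ‖G a a' b b'‖ ^ 2)
        - d * (∑ a, ∑ a', ‖∑ b, G a a' b b‖ ^ 2)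
        - d * (∑ b, ∑ b', ‖∑ a, G a a b b'‖ ^ 2)
        + ‖∑ a, ∑ b, G a a b b‖ ^ 2 := by
  rw [Finset.sum_comm (f := fun a b => G a a b b), Finset.sum_comm]
  simp only [sum_norm_sq_pairing hd hherm htr0 horth, sum_pairing, Finset.sum_sub_distrib]
  rw [← Finset.mul_sum, Finset.sum_comm]
  simp_rw [Finset.sum_comm (s := (Finset.univ : Finset (Fin (d ^ 2 - 1)))),
    sum_norm_sq_pairing hd hherm htr0 horth, Finset.sum_sub_distrib, ← Finset.mul_sum]
  ring

lemma sum_norm_sq_pairing_pairing_pairing (hd : 2 ≤ d) (hherm : ∀ i, (lam i).IsHermitian)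
    (htr0 : ∀ i, (lam i).trace = 0)
    (horth : ∀ i j, (lam i * lam j).trace = if i = j then (d : ℂ) else 0)
    (G : Fin d → Fin d → Fin d → Fin d → Fin d → Fin d → ℂ) :
    ∑ i, ∑ j, ∑ l, ‖pairing (lam i) fun a a' => pairing (lam j) fun b b' =>
        pairing (lam l) (G a a' b b')‖ ^ 2 =
      d ^ 3 * (∑ a, ∑ a', ∑ b, ∑ b', ∑ c, ∑ c', ‖G a a' b b' c c'‖ ^ 2)
        - d ^ 2 * (∑ a, ∑ a', ∑ b, ∑ b', ‖∑ c, G a a' b b' c c‖ ^ 2)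
        - d ^ 2 * (∑ a, ∑ a', ∑ c, ∑ c', ‖∑ b, G a a' b b c c'‖ ^ 2)
        - d ^ 2 * (∑ b, ∑ b', ∑ c, ∑ c', ‖∑ a, G a a b b' c c'‖ ^ 2)
        + d * (∑ a, ∑ a', ‖∑ b, ∑ c, G a a' b b c c‖ ^ 2)
        + d * (∑ b, ∑ b', ‖∑ a, ∑ c, G a a b b' c c‖ ^ 2)
        + d * (∑ c, ∑ c', ‖∑ a, ∑ b, G a a b b c c'‖ ^ 2)
        - ‖∑ a, ∑ b, ∑ c, G a a b b c c‖ ^ 2 := by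
  have h1 : ∀ j l, ∑ i, ‖pairing (lam i) fun a a' => pairing (lam j) fun b b' =>
        pairing (lam l) (G a a' b b')‖ ^ 2 =
      d * (∑ a, ∑ a', ‖pairing (lam j) fun b b' => pairing (lam l) (G a a' b b')‖ ^ 2)
      - ‖pairing (lam j) fun b b' => pairing (lam l) fun c c' => ∑ a, G a a b b' c c'‖ ^ 2 :=
    fun j l => by
      rw [sum_norm_sq_pairing hd hherm htr0 horth, sum_pairing]
      simp only [sum_pairing]
  have h2 : ∑ i, ∑ j, ∑ l, ‖pairing (lam i) fun a a' => pairing (lam j) fun b b' =>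
        pairing (lam l) (G a a' b b')‖ ^ 2 = ∑ j, ∑ l, ∑ i, ‖pairing (lam i) fun a a' =>
        pairing (lam j) fun b b' => pairing (lam l) (G a a' b b')‖ ^ 2 := by
    rw [Finset.sum_comm]
    exact Finset.sum_congr rfl fun j _ => Finset.sum_comm
  have h3 : ∑ j, ∑ l, ∑ a, ∑ a', ‖pairing (lam j) fun b b' => pairing (lam l) (G a a' b b')‖ ^ 2
      = ∑ a, ∑ a', ∑ j, ∑ l,
        ‖pairing (lam j) fun b b' => pairing (lam l) (G a a' b b')‖ ^ 2 := by
    simp_rw [Finset.sum_comm (s := (Finset.univ : Finset (Fin (d ^ 2 - 1))))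
      (t := (Finset.univ : Finset (Fin d)))]
  rw [h2]
  simp only [h1, Finset.sum_sub_distrib, ← Finset.mul_sum]
  rw [h3]
  simp only [sum_norm_sq_pairing_pairing hd hherm htr0 horth, Finset.sum_sub_distrib,
    Finset.sum_add_distrib, ← Finset.mul_sum]
  have h4 : ∑ b, ∑ a, ∑ c, G a a b b c c = ∑ a, ∑ b, ∑ c, G a a b b c c := Finset.sum_comm
  have h5 : ∀ b b', ∑ c, ∑ a, G a a b b' c c = ∑ a, ∑ c, G a a b b' c c :=
    fun b b' => Finset.sum_comm
  have h6 : ∀ c c', ∑ b, ∑ a, G a a b b c c' = ∑ a, ∑ b, G a a b b c c' :=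
    fun c c' => Finset.sum_comm
  simp only [h4, h5, h6]
  ring

/-- The one-body expectation value `⟨φ|X|φ⟩`. -/
noncomputable def expect₁ (φ : Fin d → ℂ) (X : Matrix (Fin d) (Fin d) ℂ) : ℂ :=
  pairing X fun a a' => φ a * (starRingEnd ℂ) (φ a')

/-- The three-body expectation value `⟨χ|X ⊗ Y ⊗ Z|χ⟩`. -/
noncomputable def expect₃ (χ : Fin d × Fin d × Fin d → ℂ) (X Y Z : Matrix (Fin d) (Fin d) ℂ) : ℂ :=
  pairing X fun a a' => pairing Y fun b b' => pairing Z fun c c' =>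
    χ (a, b, c) * (starRingEnd ℂ) (χ (a', b', c'))

lemma sum_norm_sq_expect₁ (hd : 2 ≤ d) (hherm : ∀ i, (lam i).IsHermitian)
    (htr0 : ∀ i, (lam i).trace = 0)
    (horth : ∀ i j, (lam i * lam j).trace = if i = j then (d : ℂ) else 0)
    {φ : Fin d → ℂ} (hφ : unitNorm φ) :
    ∑ i, ‖expect₁ φ (lam i)‖ ^ 2 = d - 1 := by
  simp only [expect₁, sum_norm_sq_pairing hd hherm htr0 horth]
  have h1 : ∑ a, φ a * (starRingEnd ℂ) (φ a) = 1 := by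
    simp only [Complex.mul_conj']
    exact_mod_cast hφ
  have h2 : ∑ a, ∑ b, ‖φ a * (starRingEnd ℂ) (φ b)‖ ^ 2 = 1 := by
    simp only [norm_mul, RCLike.norm_conj, mul_pow, ← Finset.mul_sum]
    rw [← Finset.sum_mul, hφ, one_mul]
  rw [h1, h2]
  simp

lemma sum_norm_sq_expect₃_le (hd : 2 ≤ d) (hherm : ∀ i, (lam i).IsHermitian)
    (htr0 : ∀ i, (lam i).trace = 0)
    (horth : ∀ i j, (lam i * lam j).trace = if i = j then (d : ℂ) else 0)
    {χ : Fin d × Fin d × Fin d → ℂ} (hχ : unitNorm χ) :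
    ∑ i, ∑ j, ∑ l, ‖expect₃ χ (lam i) (lam j) (lam l)‖ ^ 2 ≤
      ((d : ℝ) - 1) ^ 2 * (d + 2) := by
  have hχ' : ∑ a, ∑ b, ∑ c, ‖χ (a, b, c)‖ ^ 2 = 1 := by
    simpa only [unitNorm, Fintype.sum_prod_type] using hχ
  have htot : ∑ a, ∑ a', ∑ b, ∑ b', ∑ c, ∑ c',
      ‖χ (a, b, c) * (starRingEnd ℂ) (χ (a', b', c'))‖ ^ 2 = 1 := by
    simp only [norm_mul, RCLike.norm_conj, mul_pow, ← Finset.mul_sum, ← Finset.sum_mul, hχ', mul_one]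
  have htr : ∑ a, ∑ b, ∑ c, χ (a, b, c) * (starRingEnd ℂ) (χ (a, b, c)) = 1 := by
    simp only [Complex.mul_conj']
    exact_mod_cast hχ'
  have hA := sum_norm_sq_marginal_comm fun (a : Fin d) (p : Fin d × Fin d) => χ (a, p.1, p.2)
  have hB := sum_norm_sq_marginal_comm fun (b : Fin d) (p : Fin d × Fin d) => χ (p.1, b, p.2)
  have hC := sum_norm_sq_marginal_comm fun (c : Fin d) (p : Fin d × Fin d) => χ (p.1, p.2, c)
  have hA' := one_le_card_mul_sum_norm_sq_marginal
    (fun (a : Fin d) (p : Fin d × Fin d) => χ (a, p.1, p.2)) (by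
      simpa only [Fintype.sum_prod_type] using hχ')
  have hB' := one_le_card_mul_sum_norm_sq_marginal
    (fun (b : Fin d) (p : Fin d × Fin d) => χ (p.1, b, p.2)) (by
      simp only [Fintype.sum_prod_type]
      rw [← hχ', Finset.sum_comm])
  have hC' := one_le_card_mul_sum_norm_sq_marginal
    (fun (c : Fin d) (p : Fin d × Fin d) => χ (p.1, p.2, c)) (by
      simp only [Fintype.sum_prod_type]
      rw [← hχ', Finset.sum_comm]
      exact Finset.sum_congr rfl fun a _ => Finset.sum_comm)
  simp only [sum_prod_sum_prod] at hA hB hC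
  simp only [Fintype.sum_prod_type, Fintype.card_fin] at hA hB hC hA' hB' hC'
  simp only [expect₃, sum_norm_sq_pairing_pairing_pairing hd hherm htr0 horth, htot, htr,
    ← hA, ← hB, ← hC, norm_one]
  have hd' : (0 : ℝ) ≤ (d : ℝ) - 1 := by
    have : (2 : ℝ) ≤ d := by exact_mod_cast hd
    linarith
  nlinarith [mul_le_mul_of_nonneg_left hA' hd', mul_le_mul_of_nonneg_left hB' hd',
    mul_le_mul_of_nonneg_left hC' hd']

lemma sum_norm_sq_mul_le (hd : 2 ≤ d) (hherm : ∀ i, (lam i).IsHermitian)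
    (htr0 : ∀ i, (lam i).trace = 0)
    (horth : ∀ i j, (lam i * lam j).trace = if i = j then (d : ℂ) else 0)
    {φ : Fin d → ℂ} {χ : Fin d × Fin d × Fin d → ℂ} (hφ : unitNorm φ) (hχ : unitNorm χ) :
    ∑ i, ∑ j, ∑ l, ∑ m, ‖expect₁ φ (lam i) * expect₃ χ (lam j) (lam l) (lam m)‖ ^ 2 ≤
      (((d : ℝ) - 1) * √((d - 1) * (d + 2))) ^ 2 := by
  have hd' : (0 : ℝ) ≤ (d : ℝ) - 1 := by
    have : (2 : ℝ) ≤ d := by exact_mod_cast hd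
    linarith
  simp only [norm_mul, mul_pow, ← Finset.mul_sum, ← Finset.sum_mul]
  rw [sum_norm_sq_expect₁ hd hherm htr0 horth hφ, Real.sq_sqrt (by positivity)]
  calc _ ≤ ((d : ℝ) - 1) * (((d : ℝ) - 1) ^ 2 * (d + 2)) := by
        gcongr
        exact sum_norm_sq_expect₃_le hd hherm htr0 horth hχ
    _ = _ := by ring

lemma trace_outer_mul_kron4 (ψ : Fin d × Fin d × Fin d × Fin d → ℂ)
    (W X Y Z : Matrix (Fin d) (Fin d) ℂ) :
    (outer ψ * kron4 W X Y Z).trace =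
      pairing W fun a a' => pairing X fun b b' => pairing Y fun c c' => pairing Z fun e e' =>
        ψ (a, b, c, e) * (starRingEnd ℂ) (ψ (a', b', c', e')) := by
  simp only [Matrix.trace, Matrix.diag_apply, Matrix.mul_apply, outer, kron4, Matrix.of_apply,
    sum_prod_sum_prod, pairing, Finset.sum_mul]
  iterate 8 refine Finset.sum_congr rfl fun _ _ => ?_
  ring

lemma trace_outer_mul_kron4_fst {ψ : Fin d × Fin d × Fin d × Fin d → ℂ} {φ : Fin d → ℂ}
    {χ : Fin d × Fin d × Fin d → ℂ} (h : ∀ p, ψ p = φ p.1 * χ (p.2.1, p.2.2.1, p.2.2.2))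
    (W X Y Z : Matrix (Fin d) (Fin d) ℂ) :
    (outer ψ * kron4 W X Y Z).trace = expect₁ φ W * expect₃ χ X Y Z := by
  have h' : ∀ p q, ψ p * (starRingEnd ℂ) (ψ q) = φ p.1 * (starRingEnd ℂ) (φ q.1) *
      (χ (p.2.1, p.2.2.1, p.2.2.2) * (starRingEnd ℂ) (χ (q.2.1, q.2.2.1, q.2.2.2))) := fun p q => by
    rw [h, h, map_mul, mul_mul_mul_comm]
  simp only [trace_outer_mul_kron4, h', pairing_mul_left, pairing_mul_right, expect₁, expect₃]

lemma trace_outer_mul_kron4_snd {ψ : Fin d × Fin d × Fin d × Fin d → ℂ} {φ : Fin d → ℂ}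
    {χ : Fin d × Fin d × Fin d → ℂ} (h : ∀ p, ψ p = φ p.2.1 * χ (p.1, p.2.2.1, p.2.2.2))
    (W X Y Z : Matrix (Fin d) (Fin d) ℂ) :
    (outer ψ * kron4 W X Y Z).trace = expect₁ φ X * expect₃ χ W Y Z := by
  have h' : ∀ p q, ψ p * (starRingEnd ℂ) (ψ q) = φ p.2.1 * (starRingEnd ℂ) (φ q.2.1) *
      (χ (p.1, p.2.2.1, p.2.2.2) * (starRingEnd ℂ) (χ (q.1, q.2.2.1, q.2.2.2))) := fun p q => by
    rw [h, h, map_mul, mul_mul_mul_comm]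
  simp only [trace_outer_mul_kron4, h', pairing_mul_left, pairing_mul_right, expect₁, expect₃]

lemma trace_outer_mul_kron4_trd {ψ : Fin d × Fin d × Fin d × Fin d → ℂ} {φ : Fin d → ℂ}
    {χ : Fin d × Fin d × Fin d → ℂ} (h : ∀ p, ψ p = φ p.2.2.1 * χ (p.1, p.2.1, p.2.2.2))
    (W X Y Z : Matrix (Fin d) (Fin d) ℂ) :
    (outer ψ * kron4 W X Y Z).trace = expect₁ φ Y * expect₃ χ W X Z := by
  have h' : ∀ p q, ψ p * (starRingEnd ℂ) (ψ q) = φ p.2.2.1 * (starRingEnd ℂ) (φ q.2.2.1) *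
      (χ (p.1, p.2.1, p.2.2.2) * (starRingEnd ℂ) (χ (q.1, q.2.1, q.2.2.2))) := fun p q => by
    rw [h, h, map_mul, mul_mul_mul_comm]
  simp only [trace_outer_mul_kron4, h', pairing_mul_left, pairing_mul_right, expect₁, expect₃]

lemma trace_outer_mul_kron4_fth {ψ : Fin d × Fin d × Fin d × Fin d → ℂ} {φ : Fin d → ℂ}
    {χ : Fin d × Fin d × Fin d → ℂ} (h : ∀ p, ψ p = φ p.2.2.2 * χ (p.1, p.2.1, p.2.2.1))
    (W X Y Z : Matrix (Fin d) (Fin d) ℂ) :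
    (outer ψ * kron4 W X Y Z).trace = expect₁ φ Z * expect₃ χ W X Y := by
  have h' : ∀ p q, ψ p * (starRingEnd ℂ) (ψ q) = φ p.2.2.2 * (starRingEnd ℂ) (φ q.2.2.2) *
      (χ (p.1, p.2.1, p.2.2.1) * (starRingEnd ℂ) (χ (q.1, q.2.1, q.2.2.1))) := fun p q => by
    rw [h, h, map_mul, mul_mul_mul_comm]
  simp only [trace_outer_mul_kron4, h', pairing_mul_left, pairing_mul_right, expect₁, expect₃]

end Correlation

/-- Lemma 4.1, part 2: if a pure four-qudit state is biseparable as one particle versus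
the remaining three, then the Ky Fan `k`-norm of the realigned matrix `M^{(AB)(CD)}`
is at most `√k (d-1) √((d-1)(d+2))`. -/
theorem kyFan_bound_one_vs_three (d : ℕ) (hd : 2 ≤ d)
    (lam : Fin (d ^ 2 - 1) → Matrix (Fin d) (Fin d) ℂ)
    (hherm : ∀ i, (lam i).IsHermitian)
    (htr0 : ∀ i, (lam i).trace = 0)
    (horth : ∀ i j, (lam i * lam j).trace = if i = j then (d : ℂ) else 0)
    (ψ : Fin d × Fin d × Fin d × Fin d → ℂ)
    (hsep :
      (∃ (φ : Fin d → ℂ) (χ : Fin d × Fin d × Fin d → ℂ), unitNorm φ ∧ unitNorm χ ∧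
        ∀ p, ψ p = φ p.1 * χ (p.2.1, p.2.2.1, p.2.2.2)) ∨
      (∃ (φ : Fin d → ℂ) (χ : Fin d × Fin d × Fin d → ℂ), unitNorm φ ∧ unitNorm χ ∧
        ∀ p, ψ p = φ p.2.1 * χ (p.1, p.2.2.1, p.2.2.2)) ∨
      (∃ (φ : Fin d → ℂ) (χ : Fin d × Fin d × Fin d → ℂ), unitNorm φ ∧ unitNorm χ ∧
        ∀ p, ψ p = φ p.2.2.1 * χ (p.1, p.2.1, p.2.2.2)) ∨
      (∃ (φ : Fin d → ℂ) (χ : Fin d × Fin d × Fin d → ℂ), unitNorm φ ∧ unitNorm χ ∧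
        ∀ p, ψ p = φ p.2.2.2 * χ (p.1, p.2.1, p.2.2.1)))
    (ρ : Matrix (Fin d × Fin d × Fin d × Fin d) (Fin d × Fin d × Fin d × Fin d) ℂ)
    (hρ : ρ = outer ψ)
    (k : ℕ) (hk1 : 1 ≤ k) (hk2 : k ≤ (d ^ 2 - 1) ^ 2) :
    kyFan k (MABCD lam ρ) ≤
      Real.sqrt k * ((d : ℝ) - 1) * Real.sqrt (((d : ℝ) - 1) * ((d : ℝ) + 2)) := by
  subst hρ
  have key : ∑ p, ∑ q, ‖MABCD lam (outer ψ) p q‖ ^ 2 ≤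
      (((d : ℝ) - 1) * √((d - 1) * (d + 2))) ^ 2 := by
    simp only [MABCD, Matrix.of_apply, Fintype.sum_prod_type]
    rcases hsep with ⟨φ, χ, hφ, hχ, h⟩ | ⟨φ, χ, hφ, hχ, h⟩ | ⟨φ, χ, hφ, hχ, h⟩ |
      ⟨φ, χ, hφ, hχ, h⟩
    · simp only [trace_outer_mul_kron4_fst h]
      exact sum_norm_sq_mul_le hd hherm htr0 horth hφ hχ
    · simp only [trace_outer_mul_kron4_snd h]
      rw [Finset.sum_comm]
      exact sum_norm_sq_mul_le hd hherm htr0 horth hφ hχ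
    · simp only [trace_outer_mul_kron4_trd h]
      refine le_of_eq_of_le ?_ (sum_norm_sq_mul_le hd hherm htr0 horth hφ hχ)
      exact (Finset.sum_congr rfl fun i _ => Finset.sum_comm).trans Finset.sum_comm
    · simp only [trace_outer_mul_kron4_fth h]
      refine le_of_eq_of_le ?_ (sum_norm_sq_mul_le hd hherm htr0 horth hφ hχ)
      exact (Finset.sum_congr rfl fun i _ => (Finset.sum_congr rfl fun j _ =>
        Finset.sum_comm).trans Finset.sum_comm).trans Finset.sum_comm
  have hd' : (0 : ℝ) ≤ (d : ℝ) - 1 := by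
    have : (2 : ℝ) ≤ d := by exact_mod_cast hd
    linarith
  calc _ ≤ √k * √(∑ p, ∑ q, ‖MABCD lam (outer ψ) p q‖ ^ 2) := kyFan_le_sqrt_mul_sqrt _ _
    _ ≤ √k * (((d : ℝ) - 1) * √((d - 1) * (d + 2))) := by
      gcongr
      exact (Real.sqrt_le_left (by positivity)).2 key
    _ = _ := by ring

end SpinCorrGME
end

section
/- (Lemma 4.1, part 3) Let |ψ⟩ be a pure four-qudit state that is biseparable into two pairs of particles, and let ρ = |ψ⟩⟨ψ|. Then for every integer k with 1 ≤ k ≤ (d²−1)², the Ky Fan k-norm of the realigned matrix M^{(AB)(CD)} satisfies: (i) if |ψ⟩ = |ψ_{AB}⟩ ⊗ |ψ_{CD}⟩ (so the splitting matches the realignment) then ‖M^{(AB)(CD)}‖_k ≤ d² − 1; (ii) if |ψ⟩ separates as the AC particles versus the BD particles, or as the AD particles versus the BC particles (a crossed splitting), then ‖M^{(AB)(CD)}‖_k ≤ √k·(d² − 1). -/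
open Matrix ComplexOrder

namespace SpinCorrGME

variable {d : ℕ}

variable (lam : Fin (d ^ 2 - 1) → Matrix (Fin d) (Fin d) ℂ)
variable (ρ : Matrix (Fin d × Fin d × Fin d × Fin d) (Fin d × Fin d × Fin d × Fin d) ℂ)

section SingularValues

variable {n : Type*} [Fintype n] [DecidableEq n]

theorem singularValues_nonneg (S : Matrix n n ℂ) (i : n) : 0 ≤ singularValues S i :=
  Real.sqrt_nonneg _

theorem sum_singularValues_sq (S : Matrix n n ℂ) :
    ∑ i, singularValues S i ^ 2 = ∑ p, ∑ q, ‖S p q‖ ^ 2 := by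
  have hpos := Matrix.posSemidef_conjTranspose_mul_self S
  have htr := hpos.isHermitian.trace_eq_sum_eigenvalues
  have hfro : (Sᴴ * S).trace = ((∑ p, ∑ q, ‖S p q‖ ^ 2 : ℝ) : ℂ) := by
    rw [Finset.sum_comm]
    simp [Matrix.trace, Matrix.mul_apply, Complex.conj_mul']
  rw [hfro] at htr
  have hsum : ∑ p, ∑ q, ‖S p q‖ ^ 2 = ∑ i, hpos.isHermitian.eigenvalues i :=
    Complex.ofReal_injective (htr.trans (Complex.ofReal_sum _ _).symm)
  rw [hsum]
  exact Finset.sum_congr rfl fun i _ => Real.sq_sqrt (hpos.eigenvalues_nonneg i)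

theorem sum_singularValues_le (S : Matrix n n ℂ) {b : ℝ} (hb : 0 ≤ b)
    (hS : ∑ p, ∑ q, ‖S p q‖ ^ 2 ≤ b ^ 2) (t : Finset n) :
    ∑ i ∈ t, singularValues S i ≤ Real.sqrt t.card * b := by
  refine abs_le_of_sq_le_sq' ?_ (by positivity) |>.2
  rw [mul_pow, Real.sq_sqrt (Nat.cast_nonneg _)]
  refine sq_sum_le_card_mul_sum_sq.trans (mul_le_mul_of_nonneg_left ?_ (Nat.cast_nonneg _))
  refine le_trans ?_ ((sum_singularValues_sq S).trans_le hS)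
  exact Finset.sum_le_univ_sum_of_nonneg fun i => sq_nonneg _

theorem card_singularValues_ne_zero (S : Matrix n n ℂ) :
    (Finset.univ.filter fun i => singularValues S i ≠ 0).card = S.rank := by
  have hpos := Matrix.posSemidef_conjTranspose_mul_self S
  rw [← Matrix.rank_conjTranspose_mul_self, hpos.isHermitian.rank_eq_card_non_zero_eigs,
    Fintype.card_subtype]
  exact congrArg Finset.card <| Finset.filter_congr fun i _ =>
    not_congr (Real.sqrt_eq_zero (hpos.eigenvalues_nonneg i))

theorem kyFan_le_of_forall {k : ℕ} {S : Matrix n n ℂ} {b : ℝ} (hb : 0 ≤ b)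
    (h : ∀ t : Finset n, t.card = k → ∑ i ∈ t, singularValues S i ≤ b) : kyFan k S ≤ b := by
  unfold kyFan
  split_ifs
  · exact Finset.sup'_le _ _ fun t ht => h t (Finset.mem_powersetCard.1 ht).2
  · exact hb

theorem kyFan_le_sqrt_mul (k : ℕ) (S : Matrix n n ℂ) {b : ℝ} (hb : 0 ≤ b)
    (hS : ∑ p, ∑ q, ‖S p q‖ ^ 2 ≤ b ^ 2) : kyFan k S ≤ Real.sqrt k * b :=
  kyFan_le_of_forall (by positivity) fun t ht => ht ▸ sum_singularValues_le S hb hS t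

theorem kyFan_le_sqrt_rank_mul (k : ℕ) (S : Matrix n n ℂ) {b : ℝ} (hb : 0 ≤ b)
    (hS : ∑ p, ∑ q, ‖S p q‖ ^ 2 ≤ b ^ 2) : kyFan k S ≤ Real.sqrt S.rank * b := by
  refine kyFan_le_of_forall (by positivity) fun t _ => ?_
  rw [← card_singularValues_ne_zero]
  refine le_trans ?_ (sum_singularValues_le S hb hS _)
  rw [Finset.sum_filter_ne_zero]
  exact Finset.sum_le_univ_sum_of_nonneg (singularValues_nonneg S)

end SingularValues

/-- Bessel's inequality for the Hilbert–Schmidt inner product. -/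
theorem sum_norm_trace_sq_le {n ι : Type*} [Fintype n] [Fintype ι] [DecidableEq ι]
    (e : ι → Matrix n n ℂ) {c : ℝ} (hc : 0 < c)
    (he : ∀ a b, ((e a)ᴴ * e b).trace = if a = b then ((c ^ 2 : ℝ) : ℂ) else 0)
    (X : Matrix n n ℂ) :
    ∑ a, ‖((e a)ᴴ * X).trace‖ ^ 2 ≤ c ^ 2 * ∑ p, ∑ q, ‖X p q‖ ^ 2 := by
  let vec : Matrix n n ℂ → EuclideanSpace ℂ (n × n) := fun Y => WithLp.toLp 2 fun p => Y p.1 p.2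
  have hinner (Y Z : Matrix n n ℂ) : inner ℂ (vec Y) (vec Z) = (Yᴴ * Z).trace := by
    simp only [vec, PiLp.inner_apply, RCLike.inner_apply, Fintype.sum_prod_type, Matrix.trace,
      Matrix.diag, Matrix.mul_apply, Matrix.conjTranspose_apply]
    rw [Finset.sum_comm]
    simp [mul_comm]
  have horth : Orthonormal ℂ fun a => ((c : ℂ)⁻¹) • vec (e a) := by
    rw [orthonormal_iff_ite]
    intro a b
    have hc' : (c : ℂ) ≠ 0 := by exact_mod_cast hc.ne'
    rw [inner_smul_left, inner_smul_right, hinner, he]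
    split_ifs
    · simp
      field_simp
    · simp
  have hbessel := horth.sum_inner_products_le (vec X) (s := Finset.univ)
  have hnorm : ‖vec X‖ ^ 2 = ∑ p, ∑ q, ‖X p q‖ ^ 2 := by
    simp [vec, EuclideanSpace.norm_sq_eq, Fintype.sum_prod_type]
  have hscale (a : ι) : ‖inner ℂ (((c : ℂ)⁻¹) • vec (e a)) (vec X)‖ ^ 2
      = (c ^ 2)⁻¹ * ‖((e a)ᴴ * X).trace‖ ^ 2 := by
    rw [inner_smul_left, hinner, norm_mul, mul_pow]
    simp
  simp only [hscale, ← Finset.mul_sum, hnorm] at hbessel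
  rwa [inv_mul_le_iff₀ (by positivity)] at hbessel

open Kronecker

/-- The two-body correlation matrix `tr(|φ⟩⟨φ| · λ_i ⊗ λ_j)` of a vector of `ℂ^d ⊗ ℂ^d`. -/
noncomputable def pairCorrelation (φ : Fin d × Fin d → ℂ) :
    Matrix (Fin (d ^ 2 - 1)) (Fin (d ^ 2 - 1)) ℂ :=
  Matrix.of fun i j => (vecMulVec φ (star φ) * (lam i ⊗ₖ lam j)).trace

theorem sum_norm_pairCorrelation_sq_le (hd : 0 < d)
    (hherm : ∀ i, (lam i).IsHermitian) (htr0 : ∀ i, (lam i).trace = 0)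
    (horth : ∀ i j, (lam i * lam j).trace = if i = j then (d : ℂ) else 0)
    {φ : Fin d × Fin d → ℂ} (hφ : unitNorm φ) :
    ∑ i, ∑ j, ‖pairCorrelation lam φ i j‖ ^ 2 ≤ (d : ℝ) ^ 2 - 1 := by
  let e : Option (Fin (d ^ 2 - 1) × Fin (d ^ 2 - 1)) → Matrix (Fin d × Fin d) (Fin d × Fin d) ℂ :=
    fun a => a.elim 1 fun p => lam p.1 ⊗ₖ lam p.2
  have he (a b) : ((e a)ᴴ * e b).trace = if a = b then (((d : ℝ) ^ 2 : ℝ) : ℂ) else 0 := by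
    rcases a with _ | ⟨i, j⟩ <;> rcases b with _ | ⟨l, m⟩
    · simp [e, sq]
    · simp [e, trace_kronecker, htr0]
    · simp [e, conjTranspose_kronecker, trace_kronecker, (hherm _).eq, htr0]
    · simp only [e, Option.elim, conjTranspose_kronecker, (hherm _).eq, ← mul_kronecker_mul,
        trace_kronecker, horth, Option.some.injEq, Prod.mk.injEq]
      by_cases h₁ : i = l <;> by_cases h₂ : j = m <;> simp [h₁, h₂, sq]
  have hφ' : ∑ x, ‖φ x‖ ^ 2 = 1 := hφ
  have hbessel := sum_norm_trace_sq_le e (Nat.cast_pos.2 hd : (0 : ℝ) < d) he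
    (vecMulVec φ (star φ))
  have hpure : ∑ p, ∑ q, ‖vecMulVec φ (star φ) p q‖ ^ 2 = 1 := by
    simp only [vecMulVec_apply, Pi.star_apply, norm_mul, norm_star, mul_pow, ← Finset.mul_sum]
    rw [hφ']
    simpa using hφ'
  have hone : ((1 : Matrix (Fin d × Fin d) (Fin d × Fin d) ℂ)ᴴ * vecMulVec φ (star φ)).trace
      = 1 := by
    simp only [conjTranspose_one, one_mul, trace_vecMulVec, dotProduct, Pi.star_apply,
      RCLike.star_def, Complex.mul_conj']
    exact_mod_cast hφ'
  have hsome (i j) : ((lam i ⊗ₖ lam j)ᴴ * vecMulVec φ (star φ)).trace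
      = pairCorrelation lam φ i j := by
    rw [conjTranspose_kronecker, (hherm i).eq, (hherm j).eq, trace_mul_comm]
    rfl
  rw [hpure, Fintype.sum_option, Fintype.sum_prod_type] at hbessel
  simp only [e, Option.elim, hone, hsome] at hbessel
  simp only [norm_one, one_pow, mul_one] at hbessel
  linarith

theorem trace_submatrix_mul_submatrix {m n R : Type*} [Fintype m] [Fintype n] [CommSemiring R]
    (e : m ≃ n) (X Y : Matrix n n R) :
    (X.submatrix e e * Y.submatrix e e).trace = (X * Y).trace := by
  rw [submatrix_mul_equiv]
  exact e.sum_comp fun i => (X * Y) i i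

/-- The regrouping `(a, b, c, d) ↦ ((a, b), (c, d))` of the four parties. -/
def regroupABCD (α : Type*) : α × α × α × α ≃ (α × α) × (α × α) :=
  (Equiv.prodAssoc α α (α × α)).symm

/-- The regrouping `(a, b, c, d) ↦ ((a, c), (b, d))` of the four parties. -/
def regroupACBD (α : Type*) : α × α × α × α ≃ (α × α) × (α × α) :=
  (regroupABCD α).trans (Equiv.prodProdProdComm α α α α)

/-- The regrouping `(a, b, c, d) ↦ ((a, d), (b, c))` of the four parties. -/
def regroupADBC (α : Type*) : α × α × α × α ≃ (α × α) × (α × α) :=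
  (Equiv.prodCongr (Equiv.refl α)
    (Equiv.prodCongr (Equiv.refl α) (Equiv.prodComm α α))).trans (regroupACBD α)

theorem trace_outer_mul (e : Fin d × Fin d × Fin d × Fin d ≃ (Fin d × Fin d) × (Fin d × Fin d))
    {ψ : Fin d × Fin d × Fin d × Fin d → ℂ} {φ χ : Fin d × Fin d → ℂ}
    (hψ : ∀ p, ψ p = φ (e p).1 * χ (e p).2)
    {K : Matrix (Fin d × Fin d × Fin d × Fin d) (Fin d × Fin d × Fin d × Fin d) ℂ}
    {X Y : Matrix (Fin d × Fin d) (Fin d × Fin d) ℂ}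
    (hK : ∀ p q, K p q = X (e p).1 (e q).1 * Y (e p).2 (e q).2) :
    (outer ψ * K).trace
      = (vecMulVec φ (star φ) * X).trace * (vecMulVec χ (star χ) * Y).trace := by
  have hK' : K = (X ⊗ₖ Y).submatrix e e := by
    ext p q
    exact hK p q
  have hψ' : outer ψ
      = (vecMulVec φ (star φ) ⊗ₖ vecMulVec χ (star χ)).submatrix e e := by
    ext p q
    simp only [outer, of_apply, hψ, map_mul, submatrix_apply, kroneckerMap_apply, vecMulVec_apply,
      Pi.star_apply, RCLike.star_def]
    ring
  rw [hK', hψ', trace_submatrix_mul_submatrix, ← mul_kronecker_mul, trace_kronecker]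

theorem MABCD_apply_of_AB_CD {ψ : Fin d × Fin d × Fin d × Fin d → ℂ} {φ χ : Fin d × Fin d → ℂ}
    (hψ : ∀ p, ψ p = φ (p.1, p.2.1) * χ (p.2.2.1, p.2.2.2)) (i j l m) :
    MABCD lam (outer ψ) (i, j) (l, m)
      = pairCorrelation lam φ i j * pairCorrelation lam χ l m := by
  refine trace_outer_mul (regroupABCD _) hψ fun p q => ?_
  simp only [kron4, of_apply, kroneckerMap_apply, regroupABCD, Equiv.prodAssoc_symm_apply]
  ring

theorem MABCD_apply_of_AC_BD {ψ : Fin d × Fin d × Fin d × Fin d → ℂ} {φ χ : Fin d × Fin d → ℂ}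
    (hψ : ∀ p, ψ p = φ (p.1, p.2.2.1) * χ (p.2.1, p.2.2.2)) (i j l m) :
    MABCD lam (outer ψ) (i, j) (l, m)
      = pairCorrelation lam φ i l * pairCorrelation lam χ j m := by
  refine trace_outer_mul (regroupACBD _) hψ fun p q => ?_
  simp only [kron4, of_apply, kroneckerMap_apply, regroupACBD, regroupABCD, Equiv.trans_apply,
    Equiv.prodAssoc_symm_apply, Equiv.prodProdProdComm_apply]
  ring

theorem MABCD_apply_of_AD_BC {ψ : Fin d × Fin d × Fin d × Fin d → ℂ} {φ χ : Fin d × Fin d → ℂ}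
    (hψ : ∀ p, ψ p = φ (p.1, p.2.2.2) * χ (p.2.1, p.2.2.1)) (i j l m) :
    MABCD lam (outer ψ) (i, j) (l, m)
      = pairCorrelation lam φ i m * pairCorrelation lam χ j l := by
  refine trace_outer_mul (regroupADBC _) hψ fun p q => ?_
  simp only [kron4, of_apply, kroneckerMap_apply, regroupADBC, regroupACBD, regroupABCD,
    Equiv.trans_apply, Equiv.prodAssoc_symm_apply, Equiv.prodProdProdComm_apply,
    Equiv.prodCongr_apply, Equiv.coe_prodComm, Equiv.coe_refl, Prod.map, Prod.swap, id_eq]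
  ring

theorem sum_norm_sq_eq_of_regroup {ι : Type*} [Fintype ι] {S : Matrix (ι × ι) (ι × ι) ℂ}
    {T U : Matrix ι ι ℂ} (e : ι × ι × ι × ι ≃ (ι × ι) × (ι × ι))
    (h : ∀ x : ι × ι × ι × ι, S (x.1, x.2.1) (x.2.2.1, x.2.2.2)
      = T (e x).1.1 (e x).1.2 * U (e x).2.1 (e x).2.2) :
    ∑ p, ∑ q, ‖S p q‖ ^ 2 = (∑ i, ∑ j, ‖T i j‖ ^ 2) * ∑ i, ∑ j, ‖U i j‖ ^ 2 := by
  calc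
    _ = ∑ y : (ι × ι) × (ι × ι), ‖S y.1 y.2‖ ^ 2 := (Fintype.sum_prod_type _).symm
    _ = ∑ x : ι × ι × ι × ι, ‖S (x.1, x.2.1) (x.2.2.1, x.2.2.2)‖ ^ 2 :=
      ((regroupABCD ι).sum_comp fun y => ‖S y.1 y.2‖ ^ 2).symm
    _ = ∑ x, ‖T (e x).1.1 (e x).1.2‖ ^ 2 * ‖U (e x).2.1 (e x).2.2‖ ^ 2 := by
      simp only [h, norm_mul, mul_pow]
    _ = ∑ y : (ι × ι) × (ι × ι), ‖T y.1.1 y.1.2‖ ^ 2 * ‖U y.2.1 y.2.2‖ ^ 2 :=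
      e.sum_comp fun y => ‖T y.1.1 y.1.2‖ ^ 2 * ‖U y.2.1 y.2.2‖ ^ 2
    _ = _ := by
      simp only [← Fintype.sum_prod_type', Finset.sum_mul_sum]

/-- Lemma 4.1, part 3: bounds on the Ky Fan `k`-norm of the realigned matrix
`M^{(AB)(CD)}` for a pure four-qudit state that is biseparable into two pairs of
particles: (i) for the matching splitting `AB|CD` the bound is `d²-1`;
(ii) for a crossed splitting (`AC|BD` or `AD|BC`) the bound is `√k (d²-1)`. -/
theorem kyFan_bound_two_vs_two (d : ℕ) (hd : 2 ≤ d)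
    (lam : Fin (d ^ 2 - 1) → Matrix (Fin d) (Fin d) ℂ)
    (hherm : ∀ i, (lam i).IsHermitian)
    (htr0 : ∀ i, (lam i).trace = 0)
    (horth : ∀ i j, (lam i * lam j).trace = if i = j then (d : ℂ) else 0)
    (ψ : Fin d × Fin d × Fin d × Fin d → ℂ)
    (ρ : Matrix (Fin d × Fin d × Fin d × Fin d) (Fin d × Fin d × Fin d × Fin d) ℂ)
    (hρ : ρ = outer ψ)
    (k : ℕ) (hk1 : 1 ≤ k) (hk2 : k ≤ (d ^ 2 - 1) ^ 2) :
    ((∃ (φ χ : Fin d × Fin d → ℂ), unitNorm φ ∧ unitNorm χ ∧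
        ∀ p, ψ p = φ (p.1, p.2.1) * χ (p.2.2.1, p.2.2.2)) →
      kyFan k (MABCD lam ρ) ≤ (d : ℝ) ^ 2 - 1) ∧
    (((∃ (φ χ : Fin d × Fin d → ℂ), unitNorm φ ∧ unitNorm χ ∧
        ∀ p, ψ p = φ (p.1, p.2.2.1) * χ (p.2.1, p.2.2.2)) ∨
      (∃ (φ χ : Fin d × Fin d → ℂ), unitNorm φ ∧ unitNorm χ ∧
        ∀ p, ψ p = φ (p.1, p.2.2.2) * χ (p.2.1, p.2.2.1))) →
      kyFan k (MABCD lam ρ) ≤ Real.sqrt k * ((d : ℝ) ^ 2 - 1)) := by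
  subst hρ
  have hd0 : 0 < d := by omega
  have hb : (0 : ℝ) ≤ (d : ℝ) ^ 2 - 1 := by
    have : (1 : ℝ) ≤ d := by exact_mod_cast hd0
    nlinarith
  have hfro {φ χ : Fin d × Fin d → ℂ} (hφ : unitNorm φ) (hχ : unitNorm χ) :
      (∑ i, ∑ j, ‖pairCorrelation lam φ i j‖ ^ 2) * ∑ i, ∑ j, ‖pairCorrelation lam χ i j‖ ^ 2
        ≤ ((d : ℝ) ^ 2 - 1) ^ 2 := by
    rw [sq ((d : ℝ) ^ 2 - 1)]
    exact mul_le_mul (sum_norm_pairCorrelation_sq_le lam hd0 hherm htr0 horth hφ)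
      (sum_norm_pairCorrelation_sq_le lam hd0 hherm htr0 horth hχ) (by positivity) hb
  refine ⟨?_, ?_⟩
  · rintro ⟨φ, χ, hφ, hχ, hψ⟩
    have hM := MABCD_apply_of_AB_CD lam hψ
    have hrank : (MABCD lam (outer ψ)).rank ≤ 1 := by
      have hvec : MABCD lam (outer ψ) = vecMulVec (fun p => pairCorrelation lam φ p.1 p.2)
          (fun q => pairCorrelation lam χ q.1 q.2) := by
        ext p q
        exact hM p.1 p.2 q.1 q.2
      rw [hvec]
      exact rank_vecMulVec_le _ _
    refine (kyFan_le_sqrt_rank_mul k _ hb ?_).trans (mul_le_of_le_one_left hb ?_)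
    · rw [sum_norm_sq_eq_of_regroup (regroupABCD _) fun x => hM _ _ _ _]
      exact hfro hφ hχ
    · exact Real.sqrt_le_one.2 (by exact_mod_cast hrank)
  · rintro (⟨φ, χ, hφ, hχ, hψ⟩ | ⟨φ, χ, hφ, hχ, hψ⟩) <;> refine kyFan_le_sqrt_mul k _ hb ?_
    · rw [sum_norm_sq_eq_of_regroup (regroupACBD _) fun x => MABCD_apply_of_AC_BD lam hψ _ _ _ _]
      exact hfro hφ hχ
    · rw [sum_norm_sq_eq_of_regroup (regroupADBC _) fun x => MABCD_apply_of_AD_BC lam hψ _ _ _ _]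
      exact hfro hφ hχ

end SpinCorrGME
end
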